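/- The limit superior, as m → ∞, of n_m / (m-2)^{m-2} is at most (3/4)·(1 - 1/e), i.e. n_m is asymptotically at most 0.4742·(m-2)^{m-2}. -/

import Mathlib

/-- A graph `G` is `k`-choosable if for every assignment of lists of `k` colors
to the vertices there is a proper coloring choosing each vertex's color from its list. -/
def Choosable {V : Type*} (G : SimpleGraph V) (k : ℕ) : Prop :=
  ∀ L : V → Finset ℕ, (∀ v, (L v).card = k) →
    ∃ c : V → ℕ, (∀ v, c v ∈ L v) ∧ ∀ u w, G.Adj u w → c u ≠ c w

/-- The choice number of `G` is the least `k` such that `G` is `k`-choosable. -/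
noncomputable def choiceNumber {V : Type*} (G : SimpleGraph V) : ℕ :=
  sInf {k | Choosable G k}

/-- `nm m` is the smallest integer `n` such that `ch (K_{m,n}) = m - 1`. -/
noncomputable def nm (m : ℕ) : ℕ :=
  sInf {n | choiceNumber (completeBipartiteGraph (Fin m) (Fin n)) = m - 1}

theorem Choosable.mono {V : Type*} {G : SimpleGraph V} {k l : ℕ} (h : Choosable G k)
    (hkl : k ≤ l) : Choosable G l := by
  intro L hL
  choose L' hsub hcard using fun v => Finset.exists_subset_card_eq (hkl.trans_eq (hL v).symm)
  obtain ⟨c, hc, hadj⟩ := h L' hcard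
  exact ⟨c, fun v => hsub v (hc v), hadj⟩

theorem choosable_completeBipartiteGraph_zero (m : ℕ) :
    Choosable (completeBipartiteGraph (Fin m) (Fin 0)) 1 := by
  intro L hL
  choose c hc using fun v => Finset.card_pos.mp (by rw [hL v]; exact one_pos)
  refine ⟨c, hc, ?_⟩
  rintro (u | u) (w | w) h
  · simp at h
  · exact w.elim0
  · exact u.elim0
  · exact u.elim0

/-- Adding a vertex to the right part raises the choice number by at most one. -/
theorem Choosable.completeBipartiteGraph_succ {m n k : ℕ}
    (h : Choosable (completeBipartiteGraph (Fin m) (Fin n)) k) :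
    Choosable (completeBipartiteGraph (Fin m) (Fin (n + 1))) (k + 1) := by
  intro L hL
  obtain ⟨c₀, hc₀⟩ : (L (Sum.inr (Fin.last n))).Nonempty :=
    Finset.card_pos.mp (by rw [hL]; exact k.succ_pos)
  have key : ∀ v, ∃ S ⊆ (L v).erase c₀, S.card = k := fun v =>
    Finset.exists_subset_card_eq (by have := Finset.pred_card_le_card_erase (s := L v) (a := c₀)
                                     rw [hL] at this; exact this)
  choose S hS hcard using key
  obtain ⟨c, hc, hadj⟩ := h (fun v => S (Sum.map id Fin.castSucc v)) (fun v => hcard _)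
  have hc' : ∀ v, c v ≠ c₀ ∧ c v ∈ L (Sum.map id Fin.castSucc v) := fun v =>
    Finset.mem_erase.mp (hS _ (hc v))
  have hlr : ∀ (a : Fin m) (b : Fin (n + 1)), c (Sum.inl a) ≠
      (Fin.lastCases c₀ (fun i => c (Sum.inr i)) b : ℕ) := by
    intro a b
    induction b using Fin.lastCases with
    | last => simpa using (hc' (Sum.inl a)).1
    | cast i => simpa using hadj (Sum.inl a) (Sum.inr i) (by simp)
  refine ⟨Sum.elim (fun a => c (Sum.inl a))
    (fun b => Fin.lastCases c₀ (fun i => c (Sum.inr i)) b), ?_, ?_⟩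
  · rintro (a | b)
    · exact (hc' (Sum.inl a)).2
    · induction b using Fin.lastCases with
      | last => simpa using hc₀
      | cast i => simpa using (hc' (Sum.inr i)).2
  · rintro (a | b) (a' | b') hab
    · simp at hab
    · exact hlr a b'
    · exact (hlr a' b).symm
    · simp at hab

theorem choosable_completeBipartiteGraph (m n : ℕ) :
    Choosable (completeBipartiteGraph (Fin m) (Fin n)) (n + 1) := by
  induction n with
  | zero => exact choosable_completeBipartiteGraph_zero m
  | succ n ih => exact ih.completeBipartiteGraph_succ

theorem choosable_choiceNumber_completeBipartiteGraph (m n : ℕ) :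
    Choosable (completeBipartiteGraph (Fin m) (Fin n))
      (choiceNumber (completeBipartiteGraph (Fin m) (Fin n))) :=
  Nat.sInf_mem (s := {k | Choosable (completeBipartiteGraph (Fin m) (Fin n)) k})
    ⟨n + 1, choosable_completeBipartiteGraph m n⟩

theorem nm_le_of_not_choosable {k N : ℕ} (hk : 0 < k)
    (h : ¬ Choosable (completeBipartiteGraph (Fin (k + 2)) (Fin N)) k) : nm (k + 2) ≤ N := by
  classical
  let ch : ℕ → ℕ := fun n => choiceNumber (completeBipartiteGraph (Fin (k + 2)) (Fin n))
  have hN : k + 1 ≤ ch N := by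
    by_contra! hlt
    exact h ((choosable_choiceNumber_completeBipartiteGraph _ _).mono (Nat.lt_succ_iff.mp hlt))
  have hex : ∃ n, k + 1 ≤ ch n := ⟨N, hN⟩
  refine (Nat.sInf_le ?_).trans (Nat.find_min' hex hN)
  have hge := Nat.find_spec hex
  refine le_antisymm ?_ hge
  rcases hn : Nat.find hex with _ | n
  · have : ch 0 ≤ 1 := Nat.sInf_le (choosable_completeBipartiteGraph_zero _)
    rw [hn] at hge
    omega
  · have hlt : ¬ k + 1 ≤ ch n := Nat.find_min hex (by omega)
    have : ch (n + 1) ≤ ch n + 1 := Nat.sInf_le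
      (choosable_choiceNumber_completeBipartiteGraph _ n).completeBipartiteGraph_succ
    change ch (n + 1) ≤ k + 1
    omega

/-- If every transversal of the left lists covers some right list, the complete bipartite graph
is not choosable. -/
theorem not_choosable_of_transversals {α β C : Type*} [Fintype α] [Fintype β] [Countable C]
    {k : ℕ} (A : α → Finset C) (B : β → Finset C) (hA : ∀ a, k ≤ (A a).card)
    (hB : ∀ b, k ≤ (B b).card)
    (h : ∀ c : α → C, (∀ a, c a ∈ A a) → ∃ b, ∀ x ∈ B b, ∃ a, c a = x) :
    ¬ Choosable (completeBipartiteGraph (Fin (Fintype.card α)) (Fin (Fintype.card β))) k := by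
  intro hch
  obtain ⟨e, he⟩ := exists_injective_nat C
  choose A' hA' hAc using fun a => Finset.exists_subset_card_eq (hA a)
  choose B' hB' hBc using fun b => Finset.exists_subset_card_eq (hB b)
  let eα := Fintype.equivFin α
  let eβ := Fintype.equivFin β
  obtain ⟨c, hc, hadj⟩ := hch
    (Sum.elim (fun a => (A' (eα.symm a)).map ⟨e, he⟩) (fun b => (B' (eβ.symm b)).map ⟨e, he⟩))
    (by rintro (a | b) <;> simp [hAc, hBc])
  have hl : ∀ a, ∃ x ∈ A a, e x = c (Sum.inl (eα a)) := fun a => by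
    obtain ⟨x, hx, hxe⟩ := Finset.mem_map.mp (hc (Sum.inl (eα a)))
    exact ⟨x, hA' a (by simpa using hx), hxe⟩
  choose d hd hde using hl
  obtain ⟨b, hb⟩ := h d hd
  obtain ⟨x, hx, hxe⟩ := Finset.mem_map.mp (hc (Sum.inr (eβ b)))
  obtain ⟨a, rfl⟩ := hb x (hB' b (by simpa using hx))
  exact hadj (Sum.inl (eα a)) (Sum.inr (eβ b)) (by simp) ((hde a).symm.trans hxe)

/-- The colors of the `i`-th disjoint list that also occur in the additional list. -/
def sharedColors (n : ℕ) (i : Fin (n + 1)) : Finset (Fin (n + 3)) :=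
  if i = 0 then {0, 1, 2} else {0}

theorem card_three_colors (n : ℕ) : ({0, 1, 2} : Finset (Fin (n + 3))).card = 3 := by
  rw [Finset.card_eq_three]
  refine ⟨0, 1, 2, ?_, ?_, ?_, rfl⟩ <;> simp [Fin.ext_iff, Nat.mod_eq_of_lt (show 2 < n + 3 by omega)]

/-- The choices of one color from each disjoint list that use a shared color. -/
abbrev SharedChoice (n : ℕ) : Type :=
  {f : Fin (n + 1) → Fin (n + 3) // ∃ i, f i ∈ sharedColors n i}

theorem card_sharedChoice (n : ℕ) :
    Fintype.card (SharedChoice n) + n * (n + 2) ^ n = (n + 3) ^ (n + 1) := by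
  have h : Fintype.card {f : Fin (n + 1) → Fin (n + 3) // ¬ ∃ i, f i ∈ sharedColors n i} =
      n * (n + 2) ^ n := by
    rw [Fintype.card_of_subtype (Fintype.piFinset fun i => (sharedColors n i)ᶜ)
      (by simp [Fintype.mem_piFinset]), Fintype.card_piFinset, Fin.prod_univ_succ]
    simp only [Finset.card_compl]
    simp [sharedColors, card_three_colors, Fin.succ_ne_zero]
  have h2 := Fintype.card_subtype_compl
    (fun f : Fin (n + 1) → Fin (n + 3) => ∃ i, f i ∈ sharedColors n i)
  have h3 := Fintype.card_subtype_le
    (fun f : Fin (n + 1) → Fin (n + 3) => ∃ i, f i ∈ sharedColors n i)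
  rw [h] at h2
  have h4 : Fintype.card (Fin (n + 1) → Fin (n + 3)) = (n + 3) ^ (n + 1) := by simp
  rw [h4] at h2 h3
  change _ = _ - Fintype.card (SharedChoice n) at h2
  change Fintype.card (SharedChoice n) ≤ _ at h3
  omega

/-- The colors: those of the disjoint lists, and three blocks of size `h`. -/
abbrev Color (n h : ℕ) : Type := (Σ _ : Fin (n + 1), Fin (n + 3)) ⊕ (Fin 3 × Fin h)

/-- The disjoint lists, the list of shared colors, and the unions of two blocks. -/
def leftList (n h : ℕ) : Fin (n + 1) ⊕ Unit ⊕ Fin 3 → Finset (Color n h)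
  | .inl i => (Finset.univ.map (Function.Embedding.sigmaMk i)).map .inl
  | .inr (.inl _) => (Finset.univ.sigma (sharedColors n)).map .inl
  | .inr (.inr t) => (({t}ᶜ : Finset (Fin 3)) ×ˢ (Finset.univ : Finset (Fin h))).map .inr

/-- A choice using a shared color, together with a pair of colors from two distinct blocks. -/
def rightList (n h : ℕ) (b : SharedChoice n × Fin 3 × Fin h × Fin h) : Finset (Color n h) :=
  (Finset.univ.map ⟨fun i => (⟨i, b.1.1 i⟩ : Σ _ : Fin (n + 1), Fin (n + 3)),
    fun _ _ hij => congrArg Sigma.fst hij⟩).disjSum {(b.2.1, b.2.2.1), (b.2.1 + 1, b.2.2.2)}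

theorem not_choosable_construction {n h : ℕ} (hh : n + 3 ≤ 2 * h) :
    ¬ Choosable (completeBipartiteGraph (Fin (n + 5))
      (Fin (Fintype.card (SharedChoice n) * (3 * (h * h))))) (n + 3) := by
  have key := not_choosable_of_transversals (k := n + 3) (leftList n h) (rightList n h) ?_ ?_ ?_
  · have h1 : Fintype.card (Fin (n + 1) ⊕ Unit ⊕ Fin 3) = n + 5 := by simp
    have h2 : Fintype.card (SharedChoice n × Fin 3 × Fin h × Fin h) =
        Fintype.card (SharedChoice n) * (3 * (h * h)) := by
      simp only [Fintype.card_prod, Fintype.card_fin]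
    rwa [h1, h2] at key
  · rintro (i | _ | t)
    · simp [leftList]
    · simp [leftList, Finset.card_sigma, Fin.sum_univ_succ, sharedColors, card_three_colors,
        Fin.succ_ne_zero, add_comm]
    · simpa [leftList, Finset.card_compl] using hh
  · rintro ⟨f, s, x, y⟩
    rw [rightList, Finset.card_disjSum, Finset.card_pair]
    · simp
    · intro hs
      have : s = s + 1 := congrArg Prod.fst hs
      exact absurd this (by clear * -; revert s; decide)
  · intro c hc
    have hA : ∀ i, ∃ x, c (.inl i) = .inl ⟨i, x⟩ := fun i => by
      have := hc (.inl i)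
      simp only [leftList, Finset.mem_map] at this
      obtain ⟨_, ⟨x, _, rfl⟩, hx⟩ := this
      exact ⟨x, hx.symm⟩
    choose f hf using hA
    have hD : ∃ i, ∃ x ∈ sharedColors n i, c (.inr (.inl ())) = .inl ⟨i, x⟩ := by
      have := hc (.inr (.inl ()))
      simp only [leftList, Finset.mem_map, Finset.mem_sigma] at this
      obtain ⟨⟨i, x⟩, ⟨_, hx⟩, hx'⟩ := this
      exact ⟨i, x, hx, hx'.symm⟩
    obtain ⟨i₀, x₀, hx₀, hcx₀⟩ := hD
    have hB : ∀ t, ∃ s x, s ≠ t ∧ c (.inr (.inr t)) = .inr (s, x) := fun t => by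
      have := hc (.inr (.inr t))
      simp only [leftList, Finset.mem_map, Finset.mem_product] at this
      obtain ⟨⟨s, x⟩, ⟨hs, _⟩, hx'⟩ := this
      exact ⟨s, x, by simpa using hs, hx'.symm⟩
    choose s x hs hx using hB
    have hblocks : ∀ σ : Fin 3 → Fin 3, (∀ t, σ t ≠ t) → ∃ t t', σ t' = σ t + 1 := by decide
    obtain ⟨t, t', htt⟩ := hblocks s hs
    refine ⟨⟨⟨Function.update f i₀ x₀, i₀, by simpa using hx₀⟩, s t, x t, x t'⟩, ?_⟩
    intro z hz
    simp only [rightList, Finset.mem_disjSum, Finset.mem_map, Finset.mem_univ, true_and,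
      Finset.mem_insert, Finset.mem_singleton] at hz
    rcases hz with ⟨_, ⟨i, hi'⟩, rfl⟩ | ⟨_, rfl | rfl, rfl⟩
    · change (⟨i, Function.update f i₀ x₀ i⟩ : Σ _ : Fin (n + 1), Fin (n + 3)) = _ at hi'
      subst hi'
      by_cases hi : i = i₀
      · subst hi
        exact ⟨.inr (.inl ()), by simpa using hcx₀⟩
      · exact ⟨.inl i, by simp [hf, Function.update_of_ne hi]⟩
    · exact ⟨_, hx t⟩
    · exact ⟨_, by rw [hx t', htt]⟩

theorem nm_le (n : ℕ) :
    nm (n + 5) ≤ Fintype.card (SharedChoice n) * (3 * ((n + 4) / 2 * ((n + 4) / 2))) :=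
  nm_le_of_not_choosable (k := n + 3) (by omega) (not_choosable_construction (by omega))

theorem nm_div_le (n : ℕ) :
    (nm (n + 5) : ℝ) / ((n : ℝ) + 3) ^ (n + 3) ≤
      3 / 4 * (1 + 1 / ((n : ℝ) + 3)) ^ 2 *
        (1 - (1 - 3 / ((n : ℝ) + 3)) * (1 + (-1) / ((n + 3 : ℕ) : ℝ)) ^ (n + 3)) := by
  have hk : (0 : ℝ) < (n : ℝ) + 3 := by positivity
  have hcard : (Fintype.card (SharedChoice n) : ℝ) + n * ((n : ℝ) + 2) ^ n =
      ((n : ℝ) + 3) ^ (n + 1) := by exact_mod_cast card_sharedChoice n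
  have hhalf : (((n + 4) / 2 : ℕ) : ℝ) ≤ ((n : ℝ) + 4) / 2 := by
    have := @Nat.cast_div_le ℝ _ _ _ (n + 4) 2
    push_cast at this
    exact this
  have hnm : (nm (n + 5) : ℝ) ≤ Fintype.card (SharedChoice n) *
      (3 * ((((n + 4) / 2 : ℕ) : ℝ) * (((n + 4) / 2 : ℕ) : ℝ))) := by
    exact_mod_cast nm_le n
  have h1 : (nm (n + 5) : ℝ) ≤ Fintype.card (SharedChoice n) *
      (3 * ((((n : ℝ) + 4) / 2) * (((n : ℝ) + 4) / 2))) := hnm.trans (by gcongr)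
  set r : ℝ := 1 + (-1) / ((n + 3 : ℕ) : ℝ) with hr
  have hr' : r = ((n : ℝ) + 2) / (n + 3) := by
    rw [hr]; push_cast; field_simp; ring
  have hr0 : 0 ≤ r := by rw [hr']; positivity
  have hr1 : r ≤ 1 := by rw [hr', div_le_one hk]; linarith
  have hpow : r ^ (n + 3) ≤ r ^ n := pow_le_pow_of_le_one hr0 hr1 (by omega)
  have hn2 : ((n : ℝ) + 2) ^ n = r ^ n * (n + 3) ^ n := by
    rw [hr', ← mul_pow]; congr 1; field_simp
  have hn3 : 1 - 3 / ((n : ℝ) + 3) = n / (n + 3) := by field_simp; ring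
  have hC : (Fintype.card (SharedChoice n) : ℝ) =
      ((n : ℝ) + 3) ^ (n + 1) * (1 - n / (n + 3) * r ^ n) := by
    rw [eq_sub_of_add_eq hcard, hn2, pow_succ]; field_simp
  rw [div_le_iff₀ (by positivity), hn3]
  calc (nm (n + 5) : ℝ) ≤ _ := h1
    _ = 3 / 4 * (1 + 1 / ((n : ℝ) + 3)) ^ 2 * (1 - n / (n + 3) * r ^ n) *
        ((n : ℝ) + 3) ^ (n + 3) := by
      rw [hC, pow_add _ n 3, pow_succ]; field_simp; ring
    _ ≤ _ := by gcongr

open Filter Topology in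
theorem tendsto_nm_majorant :
    Tendsto (fun n : ℕ => 3 / 4 * (1 + 1 / ((n : ℝ) + 3)) ^ 2 *
        (1 - (1 - 3 / ((n : ℝ) + 3)) * (1 + (-1) / ((n + 3 : ℕ) : ℝ)) ^ (n + 3)))
      atTop (𝓝 ((3 / 4) * (1 - 1 / Real.exp 1))) := by
  have hk : Tendsto (fun n : ℕ => (n : ℝ) + 3) atTop atTop :=
    tendsto_atTop_add_const_right _ _ tendsto_natCast_atTop_atTop
  have he := (Real.tendsto_one_add_div_pow_exp (-1)).comp (tendsto_add_atTop_nat 3)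
  have h := (((hk.const_div_atTop 1).const_add 1).pow 2).const_mul (3 / 4) |>.mul
    ((((hk.const_div_atTop 3).const_sub 1).mul he).const_sub 1)
  have hlim : (3 / 4 : ℝ) * (1 - 1 / Real.exp 1) =
      3 / 4 * (1 + 0) ^ 2 * (1 - (1 - 0) * Real.exp (-1)) := by
    rw [Real.exp_neg]; ring
  rw [hlim]
  exact h

/-- As `m → ∞`, `n_m` is asymptotically at most `(3/4)(1 - 1/e) (m-2)^(m-2)`:
the limsup of `n_m / (m-2)^(m-2)` is at most `(3/4)(1 - 1/e) = 0.4742...`. -/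
theorem nm_asymptotic_bound :
    Filter.limsup (fun m : ℕ => (nm m : ℝ) / ((m : ℝ) - 2) ^ (m - 2)) Filter.atTop ≤
      (3 / 4) * (1 - 1 / Real.exp 1) := by
  rw [← Filter.limsup_nat_add _ 5, ← tendsto_nm_majorant.limsup_eq]
  have heq : ∀ n : ℕ, (nm (n + 5) : ℝ) / (((n + 5 : ℕ) : ℝ) - 2) ^ (n + 5 - 2) =
      (nm (n + 5) : ℝ) / ((n : ℝ) + 3) ^ (n + 3) := fun n => by
    rw [show n + 5 - 2 = n + 3 by omega]; push_cast; congr 2; ring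
  refine Filter.limsup_le_limsup (.of_forall fun n => (heq n).trans_le (nm_div_le n)) ?_
    tendsto_nm_majorant.isBoundedUnder_le
  refine Filter.IsCoboundedUnder.of_frequently_ge (a := 0) (Filter.Frequently.of_forall fun n => ?_)
  rw [heq]
  positivity
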